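/- (Global Kato smoothing in the weighted space L² with weight 1/(L−x).) Let L, T > 0. There exists a constant C = C(L,T) > 0 such that for every u ∈ C^∞([0,T]×[0,L]) satisfying u_t + u_x + u_xxx = 0 on (0,T)×(0,L) and u(t,0) = u(t,L) = u_x(t,L) = 0 for all t ∈ [0,T], one has: max_{t∈[0,T]} ∫₀^L u(t,x)²/(L−x) dx + ∫₀^T∫₀^L u_x(t,x)²/(L−x)² dx dt ≤ C ∫₀^L u(0,x)²/(L−x) dx. (The integrals converge since u(t,L) = u_x(t,L) = 0.) -/

import Mathlib

/-- Partial derivative in the space variable (second argument). -/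
noncomputable def pdx (f : ℝ → ℝ → ℝ) : ℝ → ℝ → ℝ := fun t x => deriv (f t) x

/-- Partial derivative in the time variable (first argument). -/
noncomputable def pdt (f : ℝ → ℝ → ℝ) : ℝ → ℝ → ℝ := fun t x => deriv (fun s => f s x) t

open MeasureTheory Filter Topology Set

/-- Partial `x`-derivatives of a jointly smooth function exist. -/
lemma hasDerivAt_pdx {u : ℝ → ℝ → ℝ} (hu : ContDiff ℝ (⊤ : ℕ∞) (Function.uncurry u)) (t x : ℝ) :
    HasDerivAt (u t) (pdx u t x) x := by
  have h : ContDiff ℝ (⊤ : ℕ∞) (u t) := hu.comp (contDiff_const.prodMk contDiff_id)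
  exact ((h.differentiable (by simp)) x).hasDerivAt

/-- Partial `t`-derivatives of a jointly smooth function exist. -/
lemma hasDerivAt_pdt {u : ℝ → ℝ → ℝ} (hu : ContDiff ℝ (⊤ : ℕ∞) (Function.uncurry u)) (t x : ℝ) :
    HasDerivAt (fun s => u s x) (pdt u t x) t := by
  have h : ContDiff ℝ (⊤ : ℕ∞) (fun s => u s x) :=
    hu.comp (contDiff_id.prodMk contDiff_const)
  exact ((h.differentiable (by simp)) t).hasDerivAt

lemma contDiff_pdx {u : ℝ → ℝ → ℝ} (hu : ContDiff ℝ (⊤ : ℕ∞) (Function.uncurry u)) :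
    ContDiff ℝ (⊤ : ℕ∞) (Function.uncurry (pdx u)) := by
  have h1 : ContDiff ℝ (⊤ : ℕ∞) (fun p : ℝ × ℝ => fderiv ℝ (Function.uncurry u) p (0, 1)) :=
    (hu.fderiv_right (by simp)).clm_apply contDiff_const
  convert h1 using 1
  ext ⟨t, x⟩
  have h2 := ((hu.differentiable (by simp)) (t, x)).hasFDerivAt.comp_hasDerivAt x
    ((hasDerivAt_const x t).prodMk (hasDerivAt_id x))
  exact (hasDerivAt_pdx hu t x).unique h2

lemma contDiff_pdt {u : ℝ → ℝ → ℝ} (hu : ContDiff ℝ (⊤ : ℕ∞) (Function.uncurry u)) :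
    ContDiff ℝ (⊤ : ℕ∞) (Function.uncurry (pdt u)) := by
  have h1 : ContDiff ℝ (⊤ : ℕ∞) (fun p : ℝ × ℝ => fderiv ℝ (Function.uncurry u) p (1, 0)) :=
    (hu.fderiv_right (by simp)).clm_apply contDiff_const
  convert h1 using 1
  ext ⟨t, x⟩
  have h2 := ((hu.differentiable (by simp)) (t, x)).hasFDerivAt.comp_hasDerivAt t
    ((hasDerivAt_id t).prodMk (hasDerivAt_const t x))
  exact (hasDerivAt_pdt hu t x).unique h2

/-- A globally continuous weight equal to `1 / (L + δ - x)` for `x ≤ L`. -/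
noncomputable def regWeight (L δ x : ℝ) : ℝ := (max (L + δ - x) δ)⁻¹

lemma regWeight_of_le {L δ x : ℝ} (hx : x ≤ L) : regWeight L δ x = (L + δ - x)⁻¹ := by
  rw [regWeight, max_eq_left (by linarith)]

lemma continuous_regWeight {L δ : ℝ} (hδ : 0 < δ) : Continuous (regWeight L δ) := by
  unfold regWeight
  exact Continuous.inv₀ (by fun_prop) fun x => (lt_max_of_lt_right hδ).ne'

/-- Integrated energy inequality at a fixed time: the multiplier computation combined with
Hardy's inequality. -/
lemma integral_energy_le {L δ : ℝ} (hL : 0 < L) (hδ : 0 < δ) {f f₁ f₂ f₃ g : ℝ → ℝ}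
    (h₀ : ∀ x, HasDerivAt f (f₁ x) x) (h₁ : ∀ x, HasDerivAt f₁ (f₂ x) x)
    (h₂ : ∀ x, HasDerivAt f₂ (f₃ x) x) (hg : Continuous g)
    (heq : ∀ x ∈ Ioo 0 L, g x + f₁ x + f₃ x = 0)
    (hf0 : f 0 = 0) (hfL : f L = 0) (hf₁L : f₁ L = 0) :
    ∫ x in (0:ℝ)..L, (2 * f x * g x * regWeight L δ x
      + 2 / 9 * (f₁ x ^ 2 * regWeight L δ x ^ 2) - 2 * (f x ^ 2 * regWeight L δ x)) ≤ 0 := by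
  have cf : Continuous f := continuous_iff_continuousAt.2 fun x => (h₀ x).continuousAt
  have cf₁ : Continuous f₁ := continuous_iff_continuousAt.2 fun x => (h₁ x).continuousAt
  have cw := continuous_regWeight (L := L) hδ
  set w : ℝ → ℝ := fun x => (L + δ - x)⁻¹ with hw
  have hpos : ∀ x ∈ Icc 0 L, 0 < L + δ - x := fun x hx => by linarith [hx.2]
  have dw : ∀ x ∈ Icc 0 L, HasDerivAt w (w x ^ 2) x := by
    intro x hx
    have := (((hasDerivAt_id x).const_sub (L + δ)).inv (hpos x hx).ne')
    refine this.congr_deriv ?_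
    simp [hw]
  set G : ℝ → ℝ := fun x => -(2 * (w x * f x * f₂ x)) + 2 * (w x ^ 2 * f x * f₁ x)
    + w x * f₁ x ^ 2 - 2 * (w x ^ 3 * f x ^ 2) - w x * f x ^ 2 + 25 / 6 * (w x ^ 3 * f x ^ 2)
    with hG
  have dG : ∀ x ∈ Icc 0 L, HasDerivAt G
      (-2 * w x * f x * f₃ x - 2 * w x * f x * f₁ x + 3 * w x ^ 2 * f₁ x ^ 2
        - 6 * w x ^ 4 * f x ^ 2 - w x ^ 2 * f x ^ 2
        + 25 / 6 * (3 * w x ^ 4 * f x ^ 2 + 2 * w x ^ 3 * f x * f₁ x)) x := by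
    intro x hx
    have hwx := dw x hx
    have a1 := ((hwx.mul (h₀ x)).mul (h₂ x)).const_mul 2
    have a2 := (((hwx.pow 2).mul (h₀ x)).mul (h₁ x)).const_mul 2
    have a3 := hwx.mul ((h₁ x).pow 2)
    have a4 := (hwx.pow 3).mul ((h₀ x).pow 2)
    have a5 := hwx.mul ((h₀ x).pow 2)
    refine (((((a1.neg.add a2).add a3).sub (a4.const_mul 2)).sub a5).add
      (a4.const_mul (25 / 6))).congr_deriv ?_
    simp only [Pi.mul_apply, Pi.pow_apply]
    push_cast
    ring
  have key := intervalIntegral.integral_le_sub_of_hasDeriv_right_of_le hL.le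
    (φ := fun x => 2 * f x * g x * regWeight L δ x
      + 2 / 9 * (f₁ x ^ 2 * regWeight L δ x ^ 2) - 2 * (f x ^ 2 * regWeight L δ x))
    (fun x hx => (dG x hx).continuousAt.continuousWithinAt)
    (fun x hx => (dG x (Ioo_subset_Icc_self hx)).hasDerivWithinAt)
    (Continuous.integrableOn_Icc (by fun_prop)) ?_
  · refine key.trans ?_
    have hw0 : 0 < w 0 := inv_pos.2 (hpos 0 ⟨le_rfl, hL.le⟩)
    simp only [hG, hf0, hfL, hf₁L]
    have : 0 ≤ w 0 * f₁ 0 ^ 2 := by positivity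
    nlinarith
  · intro x hx
    have hwx : 0 < w x := inv_pos.2 (hpos x (Ioo_subset_Icc_self hx))
    have hgx : g x = -f₁ x - f₃ x := by linarith [heq x hx]
    simp only [regWeight_of_le hx.2.le, hgx]
    change 2 * f x * (-f₁ x - f₃ x) * w x + 2 / 9 * (f₁ x ^ 2 * w x ^ 2)
      - 2 * (f x ^ 2 * w x) ≤ _
    have b1 : w x ^ 2 ≤ 1 / 4 * w x ^ 4 + 2 * w x := by
      rcases le_total (w x) 2 with h | h
      · nlinarith [pow_pos hwx 4]
      · nlinarith [mul_le_mul h h (by norm_num) hwx.le, pow_pos hwx 2]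
    have b2 := mul_le_mul_of_nonneg_right b1 (sq_nonneg (f x))
    nlinarith [sq_nonneg (w x * f₁ x + 3 / 2 * (w x ^ 2 * f x))]

/-- Differentiation under the integral sign for a jointly continuous derivative. -/
lemma hasDerivAt_integral_of_continuous {F F' : ℝ → ℝ → ℝ} {a b : ℝ}
    (hF : ∀ t, Continuous (F t)) (hF' : Continuous (Function.uncurry F'))
    (hd : ∀ t x, HasDerivAt (fun s => F s x) (F' t x) t) (t : ℝ) :
    HasDerivAt (fun s => ∫ x in a..b, F s x) (∫ x in a..b, F' t x) t := by
  obtain ⟨K, hK⟩ := ((isCompact_Icc (a := t - 1) (b := t + 1)).prod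
    (isCompact_uIcc (a := a) (b := b))).exists_bound_of_continuousOn hF'.continuousOn
  refine (intervalIntegral.hasDerivAt_integral_of_dominated_loc_of_deriv_le
    (bound := fun _ => K) (Icc_mem_nhds (by linarith) (by linarith) : Icc (t - 1) (t + 1) ∈ 𝓝 t)
    (.of_forall fun s => (hF s).aestronglyMeasurable) ((hF t).intervalIntegrable _ _)
    (hF'.comp (by fun_prop : Continuous fun x => (t, x))).aestronglyMeasurable
    (.of_forall fun x hx s hs => hK (s, x) ⟨hs, uIoc_subset_uIcc hx⟩)
    intervalIntegrable_const (.of_forall fun x _ s _ => hd s x)).2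

lemma norm_mul_regWeight_pow_le {L K : ℝ} {k : ℕ} {δ y x : ℝ} (hδ : 0 < δ)
    (hx : x ≤ L) (hy : |y| ≤ K * (L - x) ^ k) (hK : 0 ≤ K) : ‖y * regWeight L δ x ^ k‖ ≤ K := by
  rw [regWeight_of_le hx, Real.norm_eq_abs, inv_pow, ← div_eq_mul_inv, abs_div]
  have : 0 < L + δ - x := by linarith
  rw [abs_of_pos (pow_pos this k), div_le_iff₀ (pow_pos this k)]
  refine hy.trans (mul_le_mul_of_nonneg_left ?_ hK)
  exact pow_le_pow_left₀ (by linarith) (by linarith) k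

lemma tendsto_integral_regWeight {L K : ℝ} (hL : 0 < L) (hK : 0 ≤ K) {k : ℕ} (hk : k ≠ 0)
    {h : ℝ → ℝ} (hc : Continuous h) (hb : ∀ x ∈ Icc 0 L, |h x| ≤ K * (L - x) ^ k) :
    Tendsto (fun δ => ∫ x in (0:ℝ)..L, h x * regWeight L δ x ^ k) (𝓝[>] 0)
      (𝓝 (∫ x in (0:ℝ)..L, h x / (L - x) ^ k)) := by
  have hpos : ∀ᶠ δ : ℝ in 𝓝[>] 0, 0 < δ := self_mem_nhdsWithin
  refine intervalIntegral.tendsto_integral_filter_of_dominated_convergence (fun _ => K) ?_ ?_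
    intervalIntegrable_const ?_
  · filter_upwards [hpos] with δ hδ
    exact (hc.mul ((continuous_regWeight hδ).pow k)).aestronglyMeasurable
  · filter_upwards [hpos] with δ hδ
    refine .of_forall fun x hx => ?_
    rw [uIoc_of_le hL.le] at hx
    exact norm_mul_regWeight_pow_le hδ hx.2 (hb x (Ioc_subset_Icc_self hx)) hK
  · refine .of_forall fun x hx => ?_
    rw [uIoc_of_le hL.le] at hx
    rcases hx.2.eq_or_lt with rfl | hxL
    · have : h x = 0 := by simpa [hk] using hb x (Ioc_subset_Icc_self hx)
      simp [this]
    · simp only [regWeight_of_le hx.2, div_eq_mul_inv, ← inv_pow]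
      have : Tendsto (fun δ : ℝ => L + δ - x) (𝓝[>] 0) (𝓝 (L - x)) := by
        have : Continuous fun δ : ℝ => L + δ - x := by fun_prop
        simpa using (this.tendsto 0).mono_left nhdsWithin_le_nhds
      exact ((this.inv₀ (by linarith)).pow k).const_mul _

/-- Kato smoothing estimate for the regularised weight, uniform in `δ`. -/
lemma regularized_estimate {L T δ : ℝ} (hL : 0 < L) (hδ : 0 < δ) {u : ℝ → ℝ → ℝ}
    (hu : ContDiff ℝ (⊤ : ℕ∞) (Function.uncurry u))
    (hpde : ∀ t ∈ Ioo (0:ℝ) T, ∀ x ∈ Ioo (0:ℝ) L,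
      pdt u t x + pdx u t x + pdx (pdx (pdx u)) t x = 0)
    (hbc : ∀ t ∈ Icc (0:ℝ) T, u t 0 = 0 ∧ u t L = 0 ∧ pdx u t L = 0)
    {t : ℝ} (ht : t ∈ Icc (0:ℝ) T) :
    (∫ x in (0:ℝ)..L, u t x ^ 2 * regWeight L δ x ^ 1)
      + 2 / 9 * (∫ τ in (0:ℝ)..t, ∫ x in (0:ℝ)..L, pdx u τ x ^ 2 * regWeight L δ x ^ 2) ≤
    Real.exp (2 * T) * ∫ x in (0:ℝ)..L, u 0 x ^ 2 * regWeight L δ x ^ 1 := by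
  have cu : Continuous (Function.uncurry u) := hu.continuous
  have cux : Continuous (Function.uncurry (pdx u)) := (contDiff_pdx hu).continuous
  have cut : Continuous (Function.uncurry (pdt u)) := (contDiff_pdt hu).continuous
  have cw := continuous_regWeight (L := L) hδ
  have su : ∀ s, Continuous (u s) := fun s => cu.comp (by fun_prop : Continuous fun x => (s, x))
  have sux : ∀ s, Continuous (pdx u s) :=
    fun s => cux.comp (by fun_prop : Continuous fun x => (s, x))
  have sut : ∀ s, Continuous (pdt u s) :=
    fun s => cut.comp (by fun_prop : Continuous fun x => (s, x))
  set E : ℝ → ℝ := fun s => ∫ x in (0:ℝ)..L, u s x ^ 2 * regWeight L δ x ^ 1 with hE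
  set V : ℝ → ℝ := fun s => ∫ x in (0:ℝ)..L, pdx u s x ^ 2 * regWeight L δ x ^ 2 with hV
  set D : ℝ → ℝ := fun s => ∫ x in (0:ℝ)..L, 2 * u s x * pdt u s x * regWeight L δ x with hD
  have cV : Continuous V := by
    refine intervalIntegral.continuous_parametric_intervalIntegral_of_continuous' ?_ _ _
    exact (cux.pow 2).mul ((cw.comp continuous_snd).pow 2)
  have dE : ∀ s, HasDerivAt E (D s) s := by
    refine hasDerivAt_integral_of_continuous (fun s => ((su s).pow 2).mul (cw.pow 1)) ?_ ?_
    · exact ((continuous_const.mul cu).mul cut).mul (cw.comp continuous_snd)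
    · intro s x
      refine (((hasDerivAt_pdt hu s x).pow 2).mul_const _).congr_deriv ?_
      push_cast
      ring
  have hVnn : ∀ s, 0 ≤ V s := fun s =>
    intervalIntegral.integral_nonneg hL.le fun x _ => by positivity
  have hEnn : ∀ s, 0 ≤ E s := fun s =>
    intervalIntegral.integral_nonneg hL.le fun x hx => by
      rw [regWeight_of_le hx.2]
      have : 0 < L + δ - x := by linarith [hx.2]
      positivity
  have hDE : ∀ s ∈ Ioo 0 T, D s + 2 / 9 * V s ≤ 2 * E s := by
    intro s hs
    have h := hbc s (Ioo_subset_Icc_self hs)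
    have := integral_energy_le hL hδ (hasDerivAt_pdx hu s) (hasDerivAt_pdx (contDiff_pdx hu) s)
      (hasDerivAt_pdx (contDiff_pdx (contDiff_pdx hu)) s) (sut s) (hpde s hs) h.1 h.2.1 h.2.2
    have s1 := su s
    have s2 := sux s
    have s3 := sut s
    rw [intervalIntegral.integral_sub
        (Continuous.intervalIntegrable (by fun_prop) _ _)
        (Continuous.intervalIntegrable (by fun_prop) _ _),
      intervalIntegral.integral_add
        (Continuous.intervalIntegrable (by fun_prop) _ _)
        (Continuous.intervalIntegrable (by fun_prop) _ _),
      intervalIntegral.integral_const_mul, intervalIntegral.integral_const_mul] at this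
    simp only [hE, hV, hD, pow_one]
    linarith
  have cexp : Continuous fun s : ℝ => Real.exp (-2 * s) := by fun_prop
  have hmono := intervalIntegral.integral_le_sub_of_hasDeriv_right_of_le ht.1
    (g := fun s => -(Real.exp (-2 * s) * E s))
    (g' := fun s => -(Real.exp (-2 * s) * (-2) * E s + Real.exp (-2 * s) * D s))
    (φ := fun s => Real.exp (-2 * s) * (2 / 9 * V s))
    (fun s _ => ((cexp.continuousAt).mul (dE s).continuousAt).neg.continuousWithinAt)
    (fun s _ => by
      have h1 : HasDerivAt (fun s : ℝ => Real.exp (-2 * s)) (Real.exp (-2 * s) * (-2)) s := by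
        simpa using ((hasDerivAt_id s).const_mul (-2)).exp
      exact (h1.mul (dE s)).neg.hasDerivWithinAt)
    (Continuous.integrableOn_Icc (by fun_prop))
    (fun s hs => by
      have := mul_le_mul_of_nonneg_left (hDE s ⟨hs.1, hs.2.trans_le ht.2⟩)
        (Real.exp_pos (-2 * s)).le
      linarith)
  have hlow : Real.exp (-2 * t) * (2 / 9 * ∫ s in (0:ℝ)..t, V s) ≤
      ∫ s in (0:ℝ)..t, Real.exp (-2 * s) * (2 / 9 * V s) := by
    rw [← intervalIntegral.integral_const_mul, ← intervalIntegral.integral_const_mul]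
    refine intervalIntegral.integral_mono_on ht.1
      (Continuous.intervalIntegrable (by fun_prop) _ _)
      (Continuous.intervalIntegrable (by fun_prop) _ _) fun s hs => ?_
    refine mul_le_mul_of_nonneg_right (Real.exp_le_exp.2 (by linarith [hs.2])) ?_
    linarith [hVnn s]
  have hsum : Real.exp (-2 * t) * (E t + 2 / 9 * ∫ s in (0:ℝ)..t, V s) ≤ E 0 := by
    simp only [mul_zero, Real.exp_zero] at hmono
    linarith
  calc E t + 2 / 9 * ∫ s in (0:ℝ)..t, V s
      = Real.exp (2 * t) * (Real.exp (-2 * t) * (E t + 2 / 9 * ∫ s in (0:ℝ)..t, V s)) := by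
        rw [← mul_assoc, ← Real.exp_add]; simp
    _ ≤ Real.exp (2 * t) * E 0 := mul_le_mul_of_nonneg_left hsum (Real.exp_pos _).le
    _ ≤ Real.exp (2 * T) * E 0 :=
        mul_le_mul_of_nonneg_right (Real.exp_le_exp.2 (by linarith [ht.2])) (hEnn 0)

/-- A function vanishing at `L` whose derivative is bounded grows at most linearly away from `L`. -/
lemma abs_le_mul_sub_of_hasDerivAt {L K : ℝ} {f f' : ℝ → ℝ} (hf : ∀ x, HasDerivAt f (f' x) x)
    (hb : ∀ x ∈ Icc 0 L, |f' x| ≤ K) (hfL : f L = 0) {x : ℝ} (hx : x ∈ Icc 0 L) :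
    |f x| ≤ K * (L - x) := by
  have := (convex_Icc 0 L).norm_image_sub_le_of_norm_hasDerivWithin_le
    (fun y _ => (hf y).hasDerivWithinAt) hb ⟨hx.1.trans hx.2, le_rfl⟩ hx
  rwa [hfL, sub_zero, Real.norm_eq_abs, Real.norm_eq_abs, abs_sub_comm,
    abs_of_nonneg (sub_nonneg.2 hx.2)] at this

/-- global Kato smoothing in the weighted space `L²` with weight
`1/(L−x)`:
`max_{t∈[0,T]} ∫ u(t)²/(L−x) dx + ∫∫ u_x²/(L−x)² ≤ C ∫ u(0)²/(L−x) dx`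
(the max over `t` is expressed as a bound for every `t ∈ [0,T]`). -/
theorem stmt_15 (L T : ℝ) (hL : 0 < L) (hT : 0 < T) :
    ∃ C : ℝ, 0 < C ∧
      ∀ u : ℝ → ℝ → ℝ, ContDiff ℝ (⊤ : ℕ∞) (Function.uncurry u) →
        (∀ t ∈ Set.Ioo (0:ℝ) T, ∀ x ∈ Set.Ioo (0:ℝ) L,
          pdt u t x + pdx u t x + pdx (pdx (pdx u)) t x = 0) →
        (∀ t ∈ Set.Icc (0:ℝ) T, u t 0 = 0 ∧ u t L = 0 ∧ pdx u t L = 0) →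
        ∀ t ∈ Set.Icc (0:ℝ) T,
          (∫ x in (0:ℝ)..L, (u t x) ^ 2 / (L - x))
            + (∫ τ in (0:ℝ)..T, ∫ x in (0:ℝ)..L, (pdx u τ x) ^ 2 / (L - x) ^ 2) ≤
          C * ∫ x in (0:ℝ)..L, (u 0 x) ^ 2 / (L - x) := by
  refine ⟨6 * Real.exp (2 * T), by positivity, fun u hu hpde hbc t ht => ?_⟩
  have cu : Continuous (Function.uncurry u) := hu.continuous
  have cux : Continuous (Function.uncurry (pdx u)) := (contDiff_pdx hu).continuous
  have su : ∀ s, Continuous (u s) := fun s => cu.comp (by fun_prop : Continuous fun x => (s, x))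
  have sux : ∀ s, Continuous (pdx u s) :=
    fun s => cux.comp (by fun_prop : Continuous fun x => (s, x))
  obtain ⟨M, hM⟩ := ((isCompact_Icc (a := (0:ℝ)) (b := T)).prod
    (isCompact_Icc (a := (0:ℝ)) (b := L))).exists_bound_of_continuousOn
      (contDiff_pdx (contDiff_pdx hu)).continuous.continuousOn
  have hM0 : 0 ≤ M := (norm_nonneg _).trans (hM (0, 0) ⟨⟨le_rfl, hT.le⟩, ⟨le_rfl, hL.le⟩⟩)
  have bux : ∀ s ∈ Icc (0:ℝ) T, ∀ x ∈ Icc 0 L, |pdx u s x| ≤ M * (L - x) := fun s hs x hx =>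
    abs_le_mul_sub_of_hasDerivAt (hasDerivAt_pdx (contDiff_pdx hu) s)
      (fun y hy => hM (s, y) ⟨hs, hy⟩) (hbc s hs).2.2 hx
  have bu : ∀ s ∈ Icc (0:ℝ) T, ∀ x ∈ Icc 0 L, |u s x| ≤ M * L * (L - x) := fun s hs x hx =>
    abs_le_mul_sub_of_hasDerivAt (hasDerivAt_pdx hu s)
      (fun y hy => (bux s hs y hy).trans
        (mul_le_mul_of_nonneg_left (by linarith [hy.1]) hM0)) (hbc s hs).2.1 hx
  have bux2 : ∀ s ∈ Icc (0:ℝ) T, ∀ x ∈ Icc 0 L, |pdx u s x ^ 2| ≤ M ^ 2 * (L - x) ^ 2 := by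
    intro s hs x hx
    rw [abs_pow, ← mul_pow]
    exact pow_le_pow_left₀ (abs_nonneg _) (bux s hs x hx) 2
  have bu2 : ∀ s ∈ Icc (0:ℝ) T, ∀ x ∈ Icc 0 L,
      |u s x ^ 2| ≤ (M * L) ^ 2 * L * (L - x) ^ 1 := by
    intro s hs x hx
    rw [abs_pow, pow_one, mul_assoc]
    calc |u s x| ^ 2 ≤ (M * L * (L - x)) ^ 2 := pow_le_pow_left₀ (abs_nonneg _) (bu s hs x hx) 2
      _ = (M * L) ^ 2 * ((L - x) * (L - x)) := by ring
      _ ≤ (M * L) ^ 2 * (L * (L - x)) := by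
        refine mul_le_mul_of_nonneg_left (mul_le_mul_of_nonneg_right ?_ ?_) (sq_nonneg _) <;>
          linarith [hx.1, hx.2]
  have limE : ∀ s ∈ Icc (0:ℝ) T, Tendsto
      (fun δ => ∫ x in (0:ℝ)..L, u s x ^ 2 * regWeight L δ x ^ 1) (𝓝[>] 0)
      (𝓝 (∫ x in (0:ℝ)..L, u s x ^ 2 / (L - x))) := by
    intro s hs
    simpa only [pow_one (L - _)] using tendsto_integral_regWeight hL (by positivity) one_ne_zero
      (h := fun x => u s x ^ 2) ((su s).pow 2) (bu2 s hs)
  have hpos : ∀ᶠ δ : ℝ in 𝓝[>] 0, 0 < δ := self_mem_nhdsWithin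
  have limV : Tendsto
      (fun δ => ∫ τ in (0:ℝ)..T, ∫ x in (0:ℝ)..L, pdx u τ x ^ 2 * regWeight L δ x ^ 2) (𝓝[>] 0)
      (𝓝 (∫ τ in (0:ℝ)..T, ∫ x in (0:ℝ)..L, pdx u τ x ^ 2 / (L - x) ^ 2)) := by
    refine intervalIntegral.tendsto_integral_filter_of_dominated_convergence
      (fun _ => M ^ 2 * |L - 0|) ?_ ?_ intervalIntegrable_const ?_
    · filter_upwards [hpos] with δ hδ
      refine (intervalIntegral.continuous_parametric_intervalIntegral_of_continuous'
        ?_ _ _).aestronglyMeasurable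
      exact (cux.pow 2).mul (((continuous_regWeight hδ).comp continuous_snd).pow 2)
    · filter_upwards [hpos] with δ hδ
      refine .of_forall fun s hs => ?_
      rw [uIoc_of_le hT.le] at hs
      refine intervalIntegral.norm_integral_le_of_norm_le_const fun x hx => ?_
      rw [uIoc_of_le hL.le] at hx
      exact norm_mul_regWeight_pow_le hδ hx.2
        (bux2 s (Ioc_subset_Icc_self hs) x (Ioc_subset_Icc_self hx)) (sq_nonneg M)
    · refine .of_forall fun s hs => ?_
      rw [uIoc_of_le hT.le] at hs
      exact tendsto_integral_regWeight hL (sq_nonneg M) two_ne_zero ((sux s).pow 2)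
        (bux2 s (Ioc_subset_Icc_self hs))
  refine le_of_tendsto_of_tendsto ((limE t ht).add limV)
    ((limE 0 ⟨le_rfl, hT.le⟩).const_mul (6 * Real.exp (2 * T))) ?_
  filter_upwards [hpos] with δ hδ
  have e1 := regularized_estimate hL hδ hu hpde hbc ht
  have e2 := regularized_estimate hL hδ hu hpde hbc (t := T) ⟨hT.le, le_rfl⟩
  have n1 : 0 ≤ ∫ τ in (0:ℝ)..t, ∫ x in (0:ℝ)..L, pdx u τ x ^ 2 * regWeight L δ x ^ 2 :=
    intervalIntegral.integral_nonneg ht.1 fun _ _ =>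
      intervalIntegral.integral_nonneg hL.le fun _ _ => by positivity
  have hE : ∀ s, 0 ≤ ∫ x in (0:ℝ)..L, u s x ^ 2 * regWeight L δ x ^ 1 := fun s =>
    intervalIntegral.integral_nonneg hL.le fun x hx => by
      rw [regWeight_of_le hx.2]
      have : 0 < L + δ - x := by linarith [hx.2]
      positivity
  have n3 : 0 ≤ Real.exp (2 * T) * ∫ x in (0:ℝ)..L, u 0 x ^ 2 * regWeight L δ x ^ 1 :=
    mul_nonneg (Real.exp_pos _).le (hE 0)
  linarith [hE T]
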